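/- Let G be the simple graph on six vertices v1,...,v6 whose edges are the path edges v1v2, v2v3, v3v4, v4v5, v5v6 together with the chords v2v4 and v3v5 (this is the graph G^6_75 in Harary's enumeration of six-vertex graphs). Then for every integer n ≥ 4, the crossing number of the Cartesian product G □ C_n equals 2n. -/

import Mathlib

open SimpleGraph

/-- A drawing of a simple graph in the plane: vertices are mapped to distinct
points, and each edge is mapped to a simple arc (parametrised by `[0,1]`)
joining the images of its endpoints and avoiding the images of all vertices
in its interior. -/
structure Drawing {V : Type*} (G : SimpleGraph V) where
  vertexMap : V → ℝ × ℝ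
  vertexMap_injective : Function.Injective vertexMap
  arc : G.edgeSet → ℝ → ℝ × ℝ
  arc_continuousOn : ∀ e, ContinuousOn (arc e) (Set.Icc 0 1)
  arc_injOn : ∀ e, Set.InjOn (arc e) (Set.Icc 0 1)
  arc_endpoints : ∀ e : G.edgeSet, ∃ u v : V,
    (e : Sym2 V) = s(u, v) ∧ arc e 0 = vertexMap u ∧ arc e 1 = vertexMap v
  arc_avoids_vertices : ∀ e : G.edgeSet, ∀ t ∈ Set.Ioo (0 : ℝ) 1, ∀ w : V,
    arc e t ≠ vertexMap w

/-- The crossings of a drawing: an unordered pair of distinct edges together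
with a point of the plane where the two corresponding arcs intersect away
from their endpoints. -/
def Drawing.crossings {V : Type*} {G : SimpleGraph V} (D : Drawing G) :
    Set (Sym2 G.edgeSet × (ℝ × ℝ)) :=
  { x | ∃ e f : G.edgeSet, e ≠ f ∧ x.1 = s(e, f) ∧
      (∃ s ∈ Set.Ioo (0 : ℝ) 1, D.arc e s = x.2) ∧
      (∃ t ∈ Set.Ioo (0 : ℝ) 1, D.arc f t = x.2) }

/-- The crossing number of a simple graph: the minimum number of crossings
over all drawings of the graph in the plane. -/
noncomputable def crossingNumber {V : Type*} (G : SimpleGraph V) : ℕ :=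
  sInf { n : ℕ | ∃ D : Drawing G, D.crossings.Finite ∧ D.crossings.ncard = n }

/-- The graph `G⁶₇₅`: the path `v1 v2 v3 v4 v5 v6` together with the chords `v2v4` and `v3v5`. -/
def G6_75 : SimpleGraph (Fin 6) :=
  SimpleGraph.fromEdgeSet {s(0, 1), s(1, 2), s(2, 3), s(3, 4), s(4, 5), s(1, 3), s(2, 4)}

/-! ### The van Kampen obstruction -/

/-- The total variation of a continuous logarithm along the line does not depend on the logarithm. -/
theorem sub_eq_sub_of_exp_eq {L M : ℝ → ℂ} (hL : Continuous L) (hM : Continuous M)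
    (h : ∀ t, Complex.exp (L t) = Complex.exp (M t)) (a b : ℝ) : L b - L a = M b - M a := by
  have key : L = fun t => M t + (L a - M a) := by
    refine Complex.isCoveringMap_exp.eq_of_comp_eq hL (by fun_prop) ?_ a (by ring)
    funext t
    apply Subtype.ext
    simp only [Function.comp_apply]
    rw [Complex.exp_add, Complex.exp_sub, h a, div_self (Complex.exp_ne_zero _), mul_one, h t]
  rw [congrFun key b]; ring

theorem exists_continuous_log_plane (g : ℝ × ℝ → ℂ) (hg : Continuous g) (h0 : ∀ x, g x ≠ 0) :
    ∃ L : ℝ × ℝ → ℂ, Continuous L ∧ ∀ x, Complex.exp (L x) = g x := by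
  obtain ⟨f, ⟨-, hf⟩, -⟩ := Complex.isCoveringMap_exp.existsUnique_continuousMap_lifts
    ⟨fun x => (⟨g x, h0 x⟩ : {z : ℂ // z ≠ 0}), by fun_prop⟩ 0 (Complex.log (g 0))
    (Subtype.ext (Complex.exp_log (h0 0)))
  exact ⟨f, f.continuous, fun x => congrArg Subtype.val (congrFun hf x)⟩

section VanKampen

variable {V : Type*} [LinearOrder V]

/-- `-1` on ascents and `1` on descents. -/
def ascentSign (a b : V) : ℤ := if a < b then -1 else 1

/-- A choice of the argument of `p a - p b` such that reversing the roles of `a` and `b` changes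
it by a half turn, in the direction prescribed by `ascentSign`. -/
noncomputable def orderedLog (p : V → ℂ) (a b : V) : ℂ :=
  if a < b then Complex.log (p a - p b) else Complex.log (p b - p a) + Real.pi * Complex.I

theorem exp_orderedLog {p : V → ℂ} {a b : V} (h : p a ≠ p b) :
    Complex.exp (orderedLog p a b) = p a - p b := by
  unfold orderedLog
  split_ifs
  · exact Complex.exp_log (sub_ne_zero.2 h)
  · rw [Complex.exp_add, Complex.exp_log (sub_ne_zero.2 h.symm), Complex.exp_pi_mul_I]; ring

theorem orderedLog_sub (p : V → ℂ) {a b : V} (h : a ≠ b) :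
    orderedLog p a b - orderedLog p b a = ascentSign a b * (Real.pi * Complex.I) := by
  unfold orderedLog ascentSign
  rcases lt_or_gt_of_ne h with h | h
  · simp [h, h.not_gt]
  · simp [h, h.not_gt]

/-- For a drawing of a graph by paths `γ k l` there are integers `n v k l`, measuring how the path
`γ k l` turns around the vertex `v`, such that any two disjoint paths satisfy a linear relation. -/
theorem exists_turning_numbers (p : V → ℂ) (γ : V → V → ℝ → ℂ) (hγ : ∀ i j, Continuous (γ i j))
    (h0 : ∀ i j, i < j → γ i j 0 = p i) (h1 : ∀ i j, i < j → γ i j 1 = p j) :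
    ∃ n : V → V → V → ℤ, ∀ i j k l, i < j → k < l → i ≠ k → i ≠ l → j ≠ k → j ≠ l →
      Disjoint (Set.range (γ i j)) (Set.range (γ k l)) →
      2 * (n i k l + n l i j - n j k l - n k i j) +
        (ascentSign i l + ascentSign l j + ascentSign j k + ascentSign k i) = 0 := by
  have hn : ∀ v k l, ∃ n : ℤ, k < l → ∀ L : ℝ → ℂ, Continuous L →
      (∀ t, Complex.exp (L t) = p v - γ k l t) →
      L 1 - L 0 = orderedLog p v l - orderedLog p v k + n * (2 * Real.pi * Complex.I) := by
    intro v k l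
    by_cases h : k < l ∧ ∃ L : ℝ → ℂ, Continuous L ∧ ∀ t, Complex.exp (L t) = p v - γ k l t
    · obtain ⟨hkl, L, hL, hLe⟩ := h
      have e0 : p v ≠ p k := by
        rw [← h0 k l hkl]; exact sub_ne_zero.1 (hLe 0 ▸ Complex.exp_ne_zero _)
      have e1 : p v ≠ p l := by
        rw [← h1 k l hkl]; exact sub_ne_zero.1 (hLe 1 ▸ Complex.exp_ne_zero _)
      obtain ⟨a, ha⟩ := Complex.exp_eq_exp_iff_exists_int.1
        ((hLe 0).trans ((h0 k l hkl).symm ▸ (exp_orderedLog e0).symm))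
      obtain ⟨b, hb⟩ := Complex.exp_eq_exp_iff_exists_int.1
        ((hLe 1).trans ((h1 k l hkl).symm ▸ (exp_orderedLog e1).symm))
      refine ⟨b - a, fun _ M hM hMe => ?_⟩
      rw [sub_eq_sub_of_exp_eq hM hL (fun t => by rw [hMe, hLe]) 0 1, ha, hb]
      push_cast; ring
    · exact ⟨0, fun hkl L hL hLe => absurd ⟨hkl, L, hL, hLe⟩ h⟩
  choose n hn using hn
  refine ⟨n, fun i j k l hij hkl hik hil hjk hjl hd => ?_⟩
  obtain ⟨L, hL, hLe⟩ := exists_continuous_log_plane (fun x => γ i j x.1 - γ k l x.2)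
    (((hγ i j).comp continuous_fst).sub ((hγ k l).comp continuous_snd))
    (fun x hx => Set.disjoint_left.1 hd ⟨x.1, rfl⟩ ⟨x.2, (sub_eq_zero.1 hx).symm⟩)
  have r1 := hn i k l hkl (fun t => L (0, t)) (by fun_prop) (fun t => by rw [hLe, h0 i j hij])
  have r2 := hn j k l hkl (fun t => L (1, t)) (by fun_prop) (fun t => by rw [hLe, h1 i j hij])
  have r3 := hn k i j hij (fun t => L (t, 0) + Real.pi * Complex.I) (by fun_prop) (fun t => by
    rw [Complex.exp_add, hLe, Complex.exp_pi_mul_I, h0 k l hkl]; ring)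
  have r4 := hn l i j hij (fun t => L (t, 1) + Real.pi * Complex.I) (by fun_prop) (fun t => by
    rw [Complex.exp_add, hLe, Complex.exp_pi_mul_I, h1 k l hkl]; ring)
  have s1 := orderedLog_sub p hil
  have s2 := orderedLog_sub p hjl.symm
  have s3 := orderedLog_sub p hjk
  have s4 := orderedLog_sub p hik.symm
  have e : ((2 * (n i k l + n l i j - n j k l - n k i j) +
      (ascentSign i l + ascentSign l j + ascentSign j k + ascentSign k i) : ℤ) : ℂ) *
      (Real.pi * Complex.I) = 0 := by
    push_cast
    linear_combination (-1 : ℂ) * r1 + r2 + r3 - r4 - s1 - s2 - s3 - s4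
  have hpi : (Real.pi * Complex.I : ℂ) ≠ 0 := by simp [Real.pi_ne_zero]
  exact_mod_cast (mul_eq_zero.1 e).resolve_right hpi

/-- Sets joining the vertices pairwise carry turning numbers. -/
theorem exists_turning_numbers_of_joinedIn (p : V → ℂ) (S : V → V → Set ℂ) (A : V → V → Prop)
    (hS : ∀ i j, i < j → A i j → JoinedIn (S i j) (p i) (p j)) :
    ∃ n : V → V → V → ℤ, ∀ i j k l, i < j → k < l → i ≠ k → i ≠ l → j ≠ k → j ≠ l →
      A i j → A k l → ¬ (S i j ∩ S k l).Nonempty →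
      2 * (n i k l + n l i j - n j k l - n k i j) +
        (ascentSign i l + ascentSign l j + ascentSign j k + ascentSign k i) = 0 := by
  have hγ : ∀ i j, ∃ γ : Path (p i) (p j), i < j → A i j → ∀ t, γ t ∈ S i j := fun i j => by
    by_cases h : i < j ∧ A i j
    · exact ⟨(hS i j h.1 h.2).somePath, fun _ _ => (hS i j h.1 h.2).somePath_mem⟩
    · exact ⟨(PathConnectedSpace.joined _ _).somePath, fun h1 h2 => absurd ⟨h1, h2⟩ h⟩
  choose γ hγ using hγ
  obtain ⟨n, hn⟩ := exists_turning_numbers p (fun i j => (γ i j).extend)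
    (fun i j => (γ i j).continuous_extend) (fun i j _ => (γ i j).extend_zero)
    (fun i j _ => (γ i j).extend_one)
  refine ⟨n, fun i j k l hij hkl hik hil hjk hjl a b hd =>
    hn i j k l hij hkl hik hil hjk hjl (Set.disjoint_left.2 ?_)⟩
  simp only [Path.extend_range]
  rintro _ ⟨s, rfl⟩ ⟨t, ht⟩
  exact hd ⟨_, hγ i j hij a s, ht ▸ hγ k l hkl b t⟩

end VanKampen

/-- The complete graph `K₅` is not planar, in the form of van Kampen and Flores: the hypotheses say
that two points `a`, `b` are joined to each other inside `P` and to three points `v j` inside `A j`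
and `B j`, and that `v (j + 1)` and `v (j + 2)` are joined inside `C j`. -/
theorem exists_inter_of_completeGraph {a b : ℂ} {v : Fin 3 → ℂ} {A B C : Fin 3 → Set ℂ}
    {P : Set ℂ} (hA : ∀ j, JoinedIn (A j) a (v j)) (hB : ∀ j, JoinedIn (B j) b (v j))
    (hC : ∀ j, JoinedIn (C j) (v (j + 1)) (v (j + 2))) (hP : JoinedIn P a b) :
    (∃ j k, j ≠ k ∧ (A j ∩ B k).Nonempty) ∨ (∃ j, (A j ∩ C j).Nonempty) ∨
      (∃ j, (B j ∩ C j).Nonempty) ∨ ∃ j, (P ∩ C j).Nonempty := by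
  by_contra! hcon
  obtain ⟨h1, h2, h3, h4⟩ := hcon
  let p : Fin 5 → ℂ := ![a, b, v 0, v 1, v 2]
  let S : Fin 5 → Fin 5 → Set ℂ := ![![∅, P, A 0, A 1, A 2], ![∅, ∅, B 0, B 1, B 2],
    ![∅, ∅, ∅, C 2, C 1], ![∅, ∅, ∅, ∅, C 0], ![∅, ∅, ∅, ∅, ∅]]
  obtain ⟨n, hn⟩ := exists_turning_numbers_of_joinedIn p S (fun _ _ => True) (by
    intro i j hij _
    fin_cases i <;> fin_cases j <;> first
      | exact absurd hij (by decide)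
      | exact hP
      | exact hA _
      | exact hB _
      | exact hC 0
      | exact (hC 1).symm
      | exact hC 2)
  have rel : ∀ i j k l, i < j → k < l → i ≠ k → i ≠ l → j ≠ k → j ≠ l → S i j ∩ S k l = ∅ →
      2 * (n i k l + n l i j - n j k l - n k i j) +
        (ascentSign i l + ascentSign l j + ascentSign j k + ascentSign k i) = 0 :=
    fun i j k l a1 a2 a3 a4 a5 a6 h => hn i j k l a1 a2 a3 a4 a5 a6 trivial trivial
      (Set.not_nonempty_iff_eq_empty.2 h)
  have r1 := rel 0 2 1 3 (by decide) (by decide) (by decide) (by decide) (by decide) (by decide)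
    (h1 0 1 (by decide))
  have r2 := rel 0 2 1 4 (by decide) (by decide) (by decide) (by decide) (by decide) (by decide)
    (h1 0 2 (by decide))
  have r3 := rel 0 3 1 2 (by decide) (by decide) (by decide) (by decide) (by decide) (by decide)
    (h1 1 0 (by decide))
  have r4 := rel 0 3 1 4 (by decide) (by decide) (by decide) (by decide) (by decide) (by decide)
    (h1 1 2 (by decide))
  have r5 := rel 0 4 1 2 (by decide) (by decide) (by decide) (by decide) (by decide) (by decide)
    (h1 2 0 (by decide))
  have r6 := rel 0 4 1 3 (by decide) (by decide) (by decide) (by decide) (by decide) (by decide)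
    (h1 2 1 (by decide))
  have r7 := rel 0 2 3 4 (by decide) (by decide) (by decide) (by decide) (by decide) (by decide)
    (h2 0)
  have r8 := rel 0 3 2 4 (by decide) (by decide) (by decide) (by decide) (by decide) (by decide)
    (h2 1)
  have r9 := rel 0 4 2 3 (by decide) (by decide) (by decide) (by decide) (by decide) (by decide)
    (h2 2)
  have r10 := rel 1 2 3 4 (by decide) (by decide) (by decide) (by decide) (by decide) (by decide)
    (h3 0)
  have r11 := rel 1 3 2 4 (by decide) (by decide) (by decide) (by decide) (by decide) (by decide)
    (h3 1)
  have r12 := rel 1 4 2 3 (by decide) (by decide) (by decide) (by decide) (by decide) (by decide)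
    (h3 2)
  have r13 := rel 0 1 3 4 (by decide) (by decide) (by decide) (by decide) (by decide) (by decide)
    (h4 0)
  have r14 := rel 0 1 2 4 (by decide) (by decide) (by decide) (by decide) (by decide) (by decide)
    (h4 1)
  have r15 := rel 0 1 2 3 (by decide) (by decide) (by decide) (by decide) (by decide) (by decide)
    (h4 2)
  simp only [ascentSign, Fin.reduceLT, if_true, if_false] at r1 r2 r3 r4 r5 r6 r7 r8
  simp only [ascentSign, Fin.reduceLT, if_true, if_false] at r9 r10 r11 r12 r13 r14 r15
  clear hn rel
  omega

/-- The graph `K₃₃` is not planar, in the form of van Kampen and Flores. -/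
theorem exists_inter_of_completeBipartite {u w : Fin 3 → ℂ} {S : Fin 3 → Fin 3 → Set ℂ}
    (hS : ∀ i j, JoinedIn (S i j) (u i) (w j)) :
    ∃ i j i' j', i < i' ∧ j ≠ j' ∧ (S i j ∩ S i' j').Nonempty := by
  by_contra! hcon
  let p : Fin 3 ⊕ₗ Fin 3 → ℂ := fun x => Sum.elim u w (ofLex x)
  let T : Fin 3 ⊕ₗ Fin 3 → Fin 3 ⊕ₗ Fin 3 → Set ℂ := fun x y =>
    Sum.elim (fun i => Sum.elim (fun _ => ∅) (fun j => S i j) (ofLex y)) (fun _ => ∅) (ofLex x)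
  obtain ⟨n, hn⟩ := exists_turning_numbers_of_joinedIn p T
    (fun x y => (ofLex x).isLeft ∧ (ofLex y).isRight) (by
      rintro (i | i) (j | j) _ ⟨h1, h2⟩
      · cases h2
      · exact hS i j
      · cases h1
      · cases h1)
  have rel : ∀ i j i' j', i < i' → j ≠ j' →
      2 * (n (Sum.inlₗ i) (Sum.inlₗ i') (Sum.inrₗ j') + n (Sum.inrₗ j') (Sum.inlₗ i) (Sum.inrₗ j) -
        n (Sum.inrₗ j) (Sum.inlₗ i') (Sum.inrₗ j') - n (Sum.inlₗ i') (Sum.inlₗ i) (Sum.inrₗ j)) +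
        (-1 + (if j' < j then -1 else 1) + 1 + 1 : ℤ) = 0 := by
    intro i j i' j' hi hj
    have := hn (Sum.inlₗ i) (Sum.inrₗ j) (Sum.inlₗ i') (Sum.inrₗ j') (Sum.Lex.inl_lt_inr _ _)
      (Sum.Lex.inl_lt_inr _ _) (by simpa using hi.ne) (by simp) (by simp) (by simpa using hj)
      ⟨rfl, rfl⟩ ⟨rfl, rfl⟩ (Set.not_nonempty_iff_eq_empty.2 (hcon i j i' j' hi hj))
    simpa [ascentSign, hi.not_gt] using this
  have r1 := rel 0 0 1 1 (by decide) (by decide)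
  have r2 := rel 0 0 1 2 (by decide) (by decide)
  have r3 := rel 0 1 1 0 (by decide) (by decide)
  have r4 := rel 0 1 1 2 (by decide) (by decide)
  have r5 := rel 0 2 1 0 (by decide) (by decide)
  have r6 := rel 0 2 1 1 (by decide) (by decide)
  have r7 := rel 0 0 2 1 (by decide) (by decide)
  have r8 := rel 0 0 2 2 (by decide) (by decide)
  have r9 := rel 0 1 2 0 (by decide) (by decide)
  have r10 := rel 0 1 2 2 (by decide) (by decide)
  have r11 := rel 0 2 2 0 (by decide) (by decide)
  have r12 := rel 0 2 2 1 (by decide) (by decide)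
  have r13 := rel 1 0 2 1 (by decide) (by decide)
  have r14 := rel 1 0 2 2 (by decide) (by decide)
  have r15 := rel 1 1 2 0 (by decide) (by decide)
  have r16 := rel 1 1 2 2 (by decide) (by decide)
  have r17 := rel 1 2 2 0 (by decide) (by decide)
  have r18 := rel 1 2 2 1 (by decide) (by decide)
  simp only [Fin.reduceLT, if_true, if_false] at r1 r2 r3 r4 r5 r6 r7 r8 r9
  simp only [Fin.reduceLT, if_true, if_false] at r10 r11 r12 r13 r14 r15 r16 r17 r18
  clear hn rel
  omega

/-! ### Weak drawings of the product of the diamond graph with a cycle -/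

/-- First endpoints of the edges of the diamond graph, the complete graph on `Fin 4` without the
edge `03`. -/
def diamondSrc : Fin 5 → Fin 4 := ![0, 1, 2, 0, 1]

/-- Second endpoints of the edges of the diamond graph. -/
def diamondTgt : Fin 5 → Fin 4 := ![1, 2, 3, 2, 3]

/-- The edges of the product of the diamond graph with the cycle on `Fin (m + 1)`: the edge
`(inl a, i)` is the copy of the edge `a` of the diamond in the fibre over `i`, and the edge
`(inr k, i)`, called a link, joins the copies of the vertex `k` in the fibres over `i` and
`i + 1`. -/
abbrev PrismEdge (m : ℕ) : Type := (Fin 5 ⊕ Fin 4) × Fin (m + 1)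

namespace PrismEdge

variable {m : ℕ}

/-- The first endpoint of an edge. -/
def src : PrismEdge m → Fin 4 × Fin (m + 1)
  | (Sum.inl a, i) => (diamondSrc a, i)
  | (Sum.inr k, i) => (k, i)

/-- The second endpoint of an edge. -/
def tgt : PrismEdge m → Fin 4 × Fin (m + 1)
  | (Sum.inl a, i) => (diamondTgt a, i)
  | (Sum.inr k, i) => (k, i + 1)

/-- Two edges are independent if they have no common endpoint. -/
def Indep (e f : PrismEdge m) : Prop :=
  src e ≠ src f ∧ src e ≠ tgt f ∧ tgt e ≠ src f ∧ tgt e ≠ tgt f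

instance (e f : PrismEdge m) : Decidable (Indep e f) := by unfold Indep; infer_instance

theorem Indep.symm {e f : PrismEdge m} (h : Indep e f) : Indep f e :=
  ⟨h.1.symm, h.2.2.1.symm, h.2.1.symm, h.2.2.2.symm⟩

end PrismEdge

section PrismDrawing

open PrismEdge

/-- A weak drawing: the endpoints of every edge `e` are joined inside a set `S e`, and every pair of
independent edges whose sets meet is recorded by an element of `X`. -/
structure IsWeakDrawing {m : ℕ} {κ : Type*} (p : Fin 4 × Fin (m + 1) → ℂ)
    (S : PrismEdge m → Set ℂ) (X : Finset κ) (lab : κ → Sym2 (PrismEdge m)) : Prop where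
  joinedIn : ∀ e, JoinedIn (S e) (p (src e)) (p (tgt e))
  exists_of_nonempty : ∀ e f, Indep e f → (S e ∩ S f).Nonempty → ∃ x ∈ X, lab x = s(e, f)

namespace IsWeakDrawing

variable {m : ℕ} {κ : Type*} {p : Fin 4 × Fin (m + 1) → ℂ} {S : PrismEdge m → Set ℂ}
  {X : Finset κ} {lab : κ → Sym2 (PrismEdge m)}

theorem exists_of_mem (h : IsWeakDrawing p S X lab) {T U : Set (PrismEdge m)} {z : ℂ}
    (hT : z ∈ ⋃ e ∈ T, S e) (hU : z ∈ ⋃ e ∈ U, S e) (hI : ∀ e ∈ T, ∀ f ∈ U, Indep e f) :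
    ∃ x ∈ X, ∃ e ∈ T, ∃ f ∈ U, lab x = s(e, f) := by
  simp only [Set.mem_iUnion] at hT hU
  obtain ⟨e, he, hz⟩ := hT
  obtain ⟨f, hf, hz'⟩ := hU
  obtain ⟨x, hx, hl⟩ := h.exists_of_nonempty e f (hI e he f hf) ⟨z, hz, hz'⟩
  exact ⟨x, hx, e, he, f, hf, hl⟩

theorem joinedIn_biUnion (h : IsWeakDrawing p S X lab) {T : Set (PrismEdge m)} {e : PrismEdge m}
    (he : e ∈ T) : JoinedIn (⋃ e ∈ T, S e) (p (src e)) (p (tgt e)) :=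
  (h.joinedIn e).mono (Set.subset_biUnion_of_mem he)

/-- Weak drawings can be pulled back along automorphisms. -/
theorem comap (h : IsWeakDrawing p S X lab) (v : Fin 4 × Fin (m + 1) → Fin 4 × Fin (m + 1))
    (φ ψ : PrismEdge m → PrismEdge m) (hψ : ∀ e, ψ (φ e) = e)
    (hφ : ∀ e, src (φ e) = v (src e) ∧ tgt (φ e) = v (tgt e) ∨
      src (φ e) = v (tgt e) ∧ tgt (φ e) = v (src e))
    (hv : Function.Injective v) :
    IsWeakDrawing (p ∘ v) (S ∘ φ) X (fun x => (lab x).map ψ) where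
  joinedIn e := by
    have := h.joinedIn (φ e)
    rcases hφ e with ⟨h1, h2⟩ | ⟨h1, h2⟩ <;> rw [h1, h2] at this
    exacts [this, this.symm]
  exists_of_nonempty e f hef hne := by
    have hI : Indep (φ e) (φ f) := by
      obtain ⟨h1, h2, h3, h4⟩ := hef
      rcases hφ e with ⟨e1, e2⟩ | ⟨e1, e2⟩ <;> rcases hφ f with ⟨e3, e4⟩ | ⟨e3, e4⟩ <;>
        simp only [Indep, e1, e2, e3, e4, ne_eq, hv.eq_iff] <;> tauto
    obtain ⟨x, hx, hl⟩ := h.exists_of_nonempty _ _ hI hne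
    exact ⟨x, hx, by rw [hl, Sym2.map_mk, hψ, hψ]⟩

/-- Weak drawings can be rotated. -/
theorem rotate (h : IsWeakDrawing p S X lab) (r : Fin (m + 1)) :
    IsWeakDrawing (fun u => p (u.1, u.2 + r)) (fun e => S (e.1, e.2 + r)) X
      (fun x => (lab x).map fun e => (e.1, e.2 - r)) := by
  refine h.comap (fun u => (u.1, u.2 + r)) (fun e => (e.1, e.2 + r)) (fun e => (e.1, e.2 - r))
    (fun e => by simp) ?_ ?_
  · rintro ⟨a | k, i⟩
    · exact Or.inl ⟨rfl, rfl⟩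
    · exact Or.inl ⟨rfl, by simp [tgt, add_right_comm]⟩
  · rintro ⟨k, i⟩ ⟨l, j⟩ h
    simpa using h

end IsWeakDrawing

namespace PrismEdge

variable {m : ℕ}

/-- The edges which are not in the fibre over the last vertex of the cycle. -/
def Survives (e : PrismEdge (m + 1)) : Prop := ∀ a, e ≠ (Sum.inl a, Fin.last (m + 1))

/-- The map on edges given by removing the fibre over the last vertex of the cycle. -/
def shrink (e : PrismEdge (m + 1)) : PrismEdge m := (e.1, (Fin.last m).predAbove e.2)

theorem castSucc_add_one {i : Fin (m + 1)} (hi : i ≠ Fin.last m) :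
    i.castSucc + 1 = (i + 1).castSucc := by
  ext
  rw [Fin.val_add_one_of_lt (Fin.castSucc_lt_last i), Fin.val_castSucc, Fin.val_castSucc,
    Fin.val_add_one_of_lt (Fin.lt_last_iff_ne_last.2 hi)]

theorem castSucc_last_add_one : (Fin.last m).castSucc + 1 = Fin.last (m + 1) := by
  ext
  rw [Fin.val_add_one_of_lt (Fin.castSucc_lt_last _)]
  simp

/-- Surviving edges with a common endpoint remain so when the last fibre is removed. -/
theorem Indep.of_shrink {e f : PrismEdge (m + 1)} (he : Survives e) (hf : Survives f)
    (h : Indep (shrink e) (shrink f)) : Indep e f := by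
  have key : ∀ e : PrismEdge (m + 1), Survives e → ∀ k i, (k, i) = src e ∨ (k, i) = tgt e →
      (i = Fin.last (m + 1) ∧ shrink e = (Sum.inr k, Fin.last m)) ∨
      ∃ j : Fin (m + 1), i = j.castSucc ∧ ((k, j) = src (shrink e) ∨ (k, j) = tgt (shrink e)) := by
    rintro ⟨a | l, j⟩ he k i hki
    · induction j using Fin.lastCases with
      | last => exact absurd rfl (he a)
      | cast j =>
        right
        refine ⟨j, ?_⟩
        simp only [src, tgt, Prod.mk.injEq, shrink, Fin.predAbove_last_castSucc] at hki ⊢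
        tauto
    · induction j using Fin.lastCases with
      | last =>
        simp only [src, tgt, Prod.mk.injEq, shrink, Fin.last_add_one, Fin.predAbove_right_last]
          at hki ⊢
        rcases hki with ⟨rfl, rfl⟩ | ⟨rfl, rfl⟩
        · simp
        · exact Or.inr ⟨0, by simp, Or.inr ⟨rfl, rfl⟩⟩
      | cast j =>
        simp only [src, tgt, Prod.mk.injEq, shrink, Fin.predAbove_last_castSucc] at hki ⊢
        rcases hki with ⟨rfl, rfl⟩ | ⟨rfl, rfl⟩
        · exact Or.inr ⟨j, rfl, Or.inl ⟨rfl, rfl⟩⟩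
        · by_cases hj : j = Fin.last m
          · subst hj
            exact Or.inl ⟨castSucc_last_add_one, rfl, rfl⟩
          · exact Or.inr ⟨j + 1, castSucc_add_one hj, Or.inr ⟨rfl, rfl⟩⟩
  have key2 : ∀ v, (v = src e ∨ v = tgt e) → (v = src f ∨ v = tgt f) → False := by
    rintro ⟨k, i⟩ h1 h2
    rcases key e he k i h1 with ⟨h3, h4⟩ | ⟨j, h3, h4⟩ <;>
      rcases key f hf k i h2 with ⟨h5, h6⟩ | ⟨j', h5, h6⟩
    · rw [h4, h6] at h
      exact h.1 rfl
    · exact (Fin.castSucc_lt_last j').ne (h5.symm.trans h3)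
    · exact (Fin.castSucc_lt_last j).ne (h3.symm.trans h5)
    · obtain rfl := Fin.castSucc_injective _ (h3.symm.trans h5)
      obtain ⟨h7, h8, h9, h10⟩ := h
      rcases h4 with h4 | h4 <;> rcases h6 with h6 | h6
      exacts [h7 (h4.symm.trans h6), h8 (h4.symm.trans h6), h9 (h4.symm.trans h6),
        h10 (h4.symm.trans h6)]
  exact ⟨fun h => key2 _ (Or.inl rfl) (Or.inl h), fun h => key2 _ (Or.inl rfl) (Or.inr h),
    fun h => key2 _ (Or.inr rfl) (Or.inl h), fun h => key2 _ (Or.inr rfl) (Or.inr h)⟩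

end PrismEdge

namespace IsWeakDrawing

variable {m : ℕ} {κ : Type*} {X : Finset κ}

open Classical in
/-- Removing a fibre, which also removes all intersections with its edges. -/
theorem removeLast {p : Fin 4 × Fin (m + 2) → ℂ} {S : PrismEdge (m + 1) → Set ℂ}
    {lab : κ → Sym2 (PrismEdge (m + 1))} (h : IsWeakDrawing p S X lab) :
    IsWeakDrawing (fun u => p (u.1, u.2.castSucc))
      (fun e => ⋃ f ∈ {f | Survives f ∧ shrink f = e}, S f)
      (X.filter fun x => ∀ e ∈ lab x, Survives e) (fun x => (lab x).map shrink) where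
  joinedIn := by
    rintro ⟨a | k, i⟩
    · refine h.joinedIn_biUnion (e := (Sum.inl a, i.castSucc)) ⟨fun b hb => ?_, ?_⟩
      · exact (Fin.castSucc_lt_last i).ne (congrArg Prod.snd hb)
      · simp [shrink]
    · have h1 := h.joinedIn_biUnion (e := (Sum.inr k, i.castSucc))
        (T := {f | Survives f ∧ shrink f = (Sum.inr k, i)}) ⟨fun b hb => (by cases hb),
          by simp [shrink]⟩
      by_cases hi : i = Fin.last m
      · subst hi
        have h2 := h.joinedIn_biUnion (e := (Sum.inr k, Fin.last (m + 1)))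
          (T := {f | Survives f ∧ shrink f = (Sum.inr k, Fin.last m)}) ⟨fun b hb => (by cases hb),
            by simp [shrink]⟩
        simp only [src, tgt, Fin.last_add_one] at h1 h2 ⊢
        rw [castSucc_last_add_one] at h1
        refine h1.trans ?_
        exact h2
      · simpa only [src, tgt, castSucc_add_one hi] using h1
  exists_of_nonempty := by
    rintro e f hef ⟨z, he, hf⟩
    obtain ⟨x, hx, e', he', f', hf', hl⟩ := h.exists_of_mem he hf (by
      rintro e' ⟨he', rfl⟩ f' ⟨hf', rfl⟩
      exact hef.of_shrink he' hf')
    refine ⟨x, Finset.mem_filter.2 ⟨hx, ?_⟩, ?_⟩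
    · rw [hl]
      simp only [Sym2.mem_iff]
      rintro _ (rfl | rfl)
      exacts [he'.1, hf'.1]
    · rw [hl, Sym2.map_mk, he'.2, hf'.2]

end IsWeakDrawing

theorem diamond_connected_of_ne (a₀ : Fin 5) (f : Fin 4 → Prop)
    (hf : ∀ a ≠ a₀, f (diamondSrc a) ↔ f (diamondTgt a)) (c d : Fin 4) (hc : f c) : f d := by
  classical
  have key : ∀ (a₀ : Fin 5) (g : Fin 4 → Bool),
      (∀ a ≠ a₀, g (diamondSrc a) = g (diamondTgt a)) → ∀ c d, g c = g d := by decide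
  have := key a₀ (fun c => decide (f c)) (fun a ha => decide_eq_decide.2 (hf a ha)) c d
  exact (decide_eq_decide.1 this).1 hc

theorem diamond_connected_of_vertex_ne (k : Fin 4) (f : Fin 4 → Prop)
    (hf : ∀ a, diamondSrc a ≠ k → diamondTgt a ≠ k → (f (diamondSrc a) ↔ f (diamondTgt a)))
    (c d : Fin 4) (hck : c ≠ k) (hdk : d ≠ k) (hc : f c) : f d := by
  classical
  have key : ∀ (k : Fin 4) (g : Fin 4 → Bool),
      (∀ a, diamondSrc a ≠ k → diamondTgt a ≠ k → g (diamondSrc a) = g (diamondTgt a)) →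
        ∀ c d, c ≠ k → d ≠ k → g c = g d := by decide
  have := key k (fun c => decide (f c)) (fun a ha hb => decide_eq_decide.2 (hf a ha hb)) c d hck hdk
  exact (decide_eq_decide.1 this).1 hc

namespace IsWeakDrawing

variable {m : ℕ} {κ : Type*} {p : Fin 4 × Fin (m + 1) → ℂ} {S : PrismEdge m → Set ℂ}
  {X : Finset κ} {lab : κ → Sym2 (PrismEdge m)}

/-- The vertices of a fibre are joined along all but one of the edges of the fibre. -/
theorem joinedIn_fibre (h : IsWeakDrawing p S X lab) {T : Set (PrismEdge m)} {i : Fin (m + 1)}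
    (a₀ : Fin 5) (hT : ∀ a ≠ a₀, (Sum.inl a, i) ∈ T) {c : Fin 4}
    (hc : p (c, i) ∈ ⋃ e ∈ T, S e) (d : Fin 4) : JoinedIn (⋃ e ∈ T, S e) (p (c, i)) (p (d, i)) :=
  diamond_connected_of_ne a₀ (fun d => JoinedIn (⋃ e ∈ T, S e) (p (c, i)) (p (d, i)))
    (fun a ha => ⟨fun hj => hj.trans (h.joinedIn_biUnion (hT a ha)),
      fun hj => hj.trans (h.joinedIn_biUnion (hT a ha)).symm⟩) c d (JoinedIn.refl hc)

/-- Two vertices of a fibre are joined along the edges of the fibre avoiding a third one. -/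
theorem joinedIn_fibre_of_ne (h : IsWeakDrawing p S X lab) {T : Set (PrismEdge m)} {i : Fin (m + 1)}
    {k : Fin 4} (hT : ∀ a, diamondSrc a ≠ k → diamondTgt a ≠ k → (Sum.inl a, i) ∈ T) {c d : Fin 4}
    (hck : c ≠ k) (hdk : d ≠ k) (hcd : c ≠ d) :
    JoinedIn (⋃ e ∈ T, S e) (p (c, i)) (p (d, i)) := by
  refine (diamond_connected_of_vertex_ne k
    (fun d => c = d ∨ JoinedIn (⋃ e ∈ T, S e) (p (c, i)) (p (d, i))) (fun a ha hb => ?_)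
    c d hck hdk (Or.inl rfl)).resolve_left hcd
  have hj := h.joinedIn_biUnion (hT a ha hb)
  constructor
  · rintro (rfl | h')
    exacts [Or.inr hj, Or.inr (h'.trans hj)]
  · rintro (rfl | h')
    exacts [Or.inr hj.symm, Or.inr (h'.trans hj.symm)]

open Fin.CommRing in
/-- The endpoints of the two links of a column at the vertex over `i` are joined along the other
links of the column. -/
theorem joinedIn_column (h : IsWeakDrawing p S X lab) (hm : 2 ≤ m) {T : Set (PrismEdge m)}
    {i : Fin (m + 1)} {c : Fin 4} (hT : ∀ l, l ≠ i → l ≠ i - 1 → (Sum.inr c, l) ∈ T) :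
    JoinedIn (⋃ e ∈ T, S e) (p (c, i - 1)) (p (c, i + 1)) := by
  have hz : ∀ t : ℕ, 0 < t → t ≤ m → ((t : ℕ) : Fin (m + 1)) ≠ 0 := by
    intro t h0 ht h
    have := congrArg Fin.val h
    rw [Fin.val_natCast, Nat.mod_eq_of_lt (by omega)] at this
    simp at this; omega
  have key : ∀ t : ℕ, t + 2 ≤ m →
      JoinedIn (⋃ e ∈ T, S e) (p (c, i + 1)) (p (c, i + 1 + (t + 1 : ℕ))) := by
    intro t
    induction t with
    | zero =>
      intro ht
      have := h.joinedIn_biUnion (hT (i + 1) (by simpa using hz 1 (by omega) (by omega))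
        (fun h => hz 2 (by omega) (by omega) (by push_cast; linear_combination h)))
      simpa [src, tgt] using this
    | succ t ih =>
      intro ht
      have := h.joinedIn_biUnion (hT (i + 1 + (t + 1 : ℕ))
        (fun h => hz (t + 2) (by omega) (by omega) (by push_cast at h ⊢; linear_combination h))
        (fun h => hz (t + 3) (by omega) (by omega) (by push_cast at h ⊢; linear_combination h)))
      refine (ih (by omega)).trans ?_
      have e : i + 1 + ((t + 1 + 1 : ℕ) : Fin (m + 1)) = i + 1 + ((t + 1 : ℕ) : Fin (m + 1)) + 1 := by
        push_cast; ring
      rw [e]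
      exact this
  have := (key (m - 2) (by omega)).symm
  convert this using 3
  have hm1 : (((m - 2 + 1 : ℕ) + 2 : ℕ) : Fin (m + 1)) = 0 := by
    rw [show (m - 2 + 1 : ℕ) + 2 = m + 1 by omega]
    simp
  push_cast at hm1 ⊢
  linear_combination -hm1

end IsWeakDrawing

namespace PrismEdge

variable {m : ℕ}

/-- The pairs of edges which are charged to the vertex `i` of the cycle: a link and an edge of the
fibre over `i`, or two links ending in this fibre from different sides. -/
def IsLocal (i : Fin (m + 1)) (z : Sym2 (PrismEdge m)) : Prop :=
  (∃ k l b, z = s((Sum.inr k, l), (Sum.inl b, i))) ∨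
    ∃ k k', z = s((Sum.inr k, i - 1), (Sum.inr k', i))

theorem sub_one_ne_self (hm : 2 ≤ m) (i : Fin (m + 1)) : i - 1 ≠ i := by
  intro h
  have := congrArg Fin.val (sub_eq_self.1 h)
  rw [Fin.val_one', Nat.mod_eq_of_lt (by omega)] at this
  simp at this

theorem add_one_ne_self (hm : 2 ≤ m) (i : Fin (m + 1)) : i + 1 ≠ i := fun h =>
  sub_one_ne_self hm i (by nth_rw 1 [← h]; simp)

theorem sub_one_ne_add_one (hm : 2 ≤ m) (i : Fin (m + 1)) : i - 1 ≠ i + 1 := by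
  intro h
  have h2 : (1 + 1 : Fin (m + 1)) = 0 := by
    have := sub_eq_iff_eq_add.1 h
    rwa [add_assoc, left_eq_add] at this
  have := congrArg Fin.val h2
  rw [Fin.val_add, Fin.val_one', Nat.mod_eq_of_lt (by omega : 1 < m + 1),
    Nat.mod_eq_of_lt (by omega)] at this
  simp at this

theorem IsLocal.eq (hm : 2 ≤ m) {i j : Fin (m + 1)} {z : Sym2 (PrismEdge m)} (hi : IsLocal i z)
    (hj : IsLocal j z) : i = j := by
  rcases hi with ⟨k, l, b, rfl⟩ | ⟨k, k', rfl⟩ <;> rcases hj with ⟨k₁, l₁, b₁, h⟩ | ⟨k₁, k₁', h⟩ <;>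
    simp only [Sym2.eq_iff, Prod.mk.injEq, Sum.inl.injEq, Sum.inr.injEq, reduceCtorEq, false_and,
      and_false, or_false] at h
  · exact h.2.2
  · rcases h with h | h
    · exact h.2.2
    · exact absurd (h.1.2.trans (by rw [h.2.2, sub_add_cancel])) (sub_one_ne_add_one hm i)

end PrismEdge

namespace IsWeakDrawing

variable {m : ℕ} {κ : Type*} {p : Fin 4 × Fin (m + 1) → ℂ} {S : PrismEdge m → Set ℂ}
  {X : Finset κ} {lab : κ → Sym2 (PrismEdge m)}

theorem exists_isLocal (h : IsWeakDrawing p S X lab) (hm : 2 ≤ m) {E : Fin (m + 1) → Fin 5}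
    (hE : ∀ x ∈ X, ∀ i a, (Sum.inl a, i) ∈ lab x → (Sum.inl (E i), i) ∈ lab x)
    (i : Fin (m + 1)) (k : Fin 4) :
    ∃ x ∈ X, IsLocal i (lab x) ∧ ∀ l, (Sum.inr k, l) ∉ lab x := by
  have n1 := sub_one_ne_self hm i
  have n2 := add_one_ne_self hm i
  have n3 := sub_one_ne_add_one hm i
  have hk : ∀ j, k.succAbove j ≠ k := Fin.succAbove_ne k
  have hk' : ∀ j, k ≠ k.succAbove j := fun j => (hk j).symm
  have hkk : ∀ j j', j ≠ j' → k.succAbove j ≠ k.succAbove j' := fun j j' hj =>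
    Fin.succAbove_right_injective.ne hj
  let TA : Fin 3 → Set (PrismEdge m) := fun j =>
    {e | (∃ a ≠ E (i - 1), e = (Sum.inl a, i - 1)) ∨ e = (Sum.inr (k.succAbove j), i - 1)}
  let TB : Fin 3 → Set (PrismEdge m) := fun j =>
    {e | (∃ a ≠ E (i + 1), e = (Sum.inl a, i + 1)) ∨ e = (Sum.inr (k.succAbove j), i)}
  let TC : Fin 3 → Set (PrismEdge m) := fun j =>
    {e | ∃ a, diamondSrc a ≠ k.succAbove j ∧ diamondTgt a ≠ k.succAbove j ∧ e = (Sum.inl a, i)}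
  let TP : Set (PrismEdge m) := {e | ∃ l, l ≠ i ∧ l ≠ i - 1 ∧ e = (Sum.inr (k.succAbove 0), l)}
  have hA : ∀ j, JoinedIn (⋃ e ∈ TA j, S e) (p (k.succAbove 0, i - 1)) (p (k.succAbove j, i)) := by
    intro j
    have hl := h.joinedIn_biUnion (T := TA j) (e := (Sum.inr (k.succAbove j), i - 1)) (Or.inr rfl)
    simp only [src, tgt, sub_add_cancel] at hl
    exact (h.joinedIn_fibre (E (i - 1)) (fun a ha => Or.inl ⟨a, ha, rfl⟩) hl.source_mem _).symm.trans
      hl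
  have hB : ∀ j, JoinedIn (⋃ e ∈ TB j, S e) (p (k.succAbove 0, i + 1)) (p (k.succAbove j, i)) := by
    intro j
    have hl := h.joinedIn_biUnion (T := TB j) (e := (Sum.inr (k.succAbove j), i)) (Or.inr rfl)
    exact (h.joinedIn_fibre (E (i + 1)) (fun a ha => Or.inl ⟨a, ha, rfl⟩) hl.target_mem _).symm.trans
      hl.symm
  have hC : ∀ j, JoinedIn (⋃ e ∈ TC j, S e) (p (k.succAbove (j + 1), i))
      (p (k.succAbove (j + 2), i)) := fun j =>
    h.joinedIn_fibre_of_ne (k := k.succAbove j) (T := TC j) (fun a ha hb => ⟨a, ha, hb, rfl⟩)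
      (hkk (j + 1) j (by revert j; decide)) (hkk (j + 2) j (by revert j; decide))
      (hkk (j + 1) (j + 2) (by revert j; decide))
  have hP : JoinedIn (⋃ e ∈ TP, S e) (p (k.succAbove 0, i - 1)) (p (k.succAbove 0, i + 1)) :=
    h.joinedIn_column hm (fun l h1 h2 => ⟨l, h1, h2, rfl⟩)
  rcases exists_inter_of_completeGraph hA hB hC hP with
    ⟨j, j', hj, z, hz, hz'⟩ | ⟨j, z, hz, hz'⟩ | ⟨j, z, hz, hz'⟩ | ⟨j, z, hz, hz'⟩
  · obtain ⟨x, hx, e, he, f, hf, hl⟩ := h.exists_of_mem hz hz' (by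
      rintro _ (⟨a, -, rfl⟩ | rfl) _ (⟨b, -, rfl⟩ | rfl) <;>
        simp [Indep, src, tgt, n1, n3, n2.symm, hkk j j' hj])
    have hEx := hE x hx
    rw [hl] at hEx
    refine ⟨x, hx, ?_⟩
    rw [hl]
    rcases he with ⟨a, ha, rfl⟩ | rfl
    · exfalso
      have := hEx (i - 1) a (by simp)
      rcases hf with ⟨b, -, rfl⟩ | rfl <;> simp [ha.symm, n3] at this
    · rcases hf with ⟨b, hb, rfl⟩ | rfl
      · have := hEx (i + 1) b (by simp)
        simp [hb.symm] at this
      · exact ⟨Or.inr ⟨_, _, rfl⟩, by simp [hk']⟩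
  · obtain ⟨x, hx, e, he, f, hf, hl⟩ := h.exists_of_mem hz hz' (by
      rintro _ (⟨a, -, rfl⟩ | rfl) _ ⟨b, hb, hb', rfl⟩ <;>
        simp [Indep, src, tgt, n1, hb.symm, hb'.symm])
    have hEx := hE x hx
    rw [hl] at hEx
    refine ⟨x, hx, ?_⟩
    rw [hl]
    obtain ⟨b, -, -, rfl⟩ := hf
    rcases he with ⟨a, ha, rfl⟩ | rfl
    · have := hEx (i - 1) a (by simp)
      simp [ha.symm, n1] at this
    · exact ⟨Or.inl ⟨_, _, _, rfl⟩, by simp [hk']⟩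
  · obtain ⟨x, hx, e, he, f, hf, hl⟩ := h.exists_of_mem hz hz' (by
      rintro _ (⟨a, -, rfl⟩ | rfl) _ ⟨b, hb, hb', rfl⟩ <;>
        simp [Indep, src, tgt, n2, hb.symm, hb'.symm])
    have hEx := hE x hx
    rw [hl] at hEx
    refine ⟨x, hx, ?_⟩
    rw [hl]
    obtain ⟨b, -, -, rfl⟩ := hf
    rcases he with ⟨a, ha, rfl⟩ | rfl
    · have := hEx (i + 1) a (by simp)
      simp [ha.symm, n2] at this
    · exact ⟨Or.inl ⟨_, _, _, rfl⟩, by simp [hk']⟩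
  · obtain ⟨x, hx, e, he, f, hf, hl⟩ := h.exists_of_mem hz hz' (by
      rintro _ ⟨l, h1, h2, rfl⟩ _ ⟨b, hb, hb', rfl⟩
      simp [Indep, src, tgt, h1, eq_sub_iff_add_eq.not.1 h2])
    obtain ⟨l, -, -, rfl⟩ := he
    obtain ⟨b, -, -, rfl⟩ := hf
    exact ⟨x, hx, hl ▸ Or.inl ⟨_, _, _, rfl⟩, by simp [hl, hk']⟩

open Classical in
/-- If all intersections with a fibre involve the same edge of this fibre, then there are at least
two intersections for every vertex of the cycle. -/
theorem two_mul_le_card_of_forall_fibre (h : IsWeakDrawing p S X lab) (hm : 2 ≤ m)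
    {E : Fin (m + 1) → Fin 5}
    (hE : ∀ x ∈ X, ∀ i a, (Sum.inl a, i) ∈ lab x → (Sum.inl (E i), i) ∈ lab x) :
    2 * (m + 1) ≤ X.card := by
  have h2 : ∀ i, 2 ≤ (X.filter fun x => IsLocal i (lab x)).card := by
    intro i
    obtain ⟨x, hx, hxl, -⟩ := h.exists_isLocal hm hE i 0
    obtain ⟨k, l, hk⟩ : ∃ k l, (Sum.inr k, l) ∈ lab x := by
      rcases hxl with ⟨k, l, b, h⟩ | ⟨k, k', h⟩
      exacts [⟨k, l, by simp [h]⟩, ⟨k, i - 1, by simp [h]⟩]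
    obtain ⟨y, hy, hyl, hk'⟩ := h.exists_isLocal hm hE i k
    exact Finset.one_lt_card.2 ⟨x, Finset.mem_filter.2 ⟨hx, hxl⟩, y, Finset.mem_filter.2 ⟨hy, hyl⟩,
      fun e => hk' l (e ▸ hk)⟩
  calc 2 * (m + 1) = ∑ _i : Fin (m + 1), 2 := by simp [mul_comm]
    _ ≤ ∑ i, (X.filter fun x => IsLocal i (lab x)).card := Finset.sum_le_sum fun i _ => h2 i
    _ = (Finset.univ.biUnion fun i => X.filter fun x => IsLocal i (lab x)).card := by
      refine (Finset.card_biUnion fun i _ j _ hij => ?_).symm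
      exact Finset.disjoint_filter.2 fun x _ hi hj => hij (hi.eq hm hj)
    _ ≤ X.card := Finset.card_le_card (Finset.biUnion_subset.2 fun i _ => Finset.filter_subset _ _)

end IsWeakDrawing

/-! ### The case of three fibres -/

namespace PrismEdge

/-- `u.IsWalk l v` says that the list of edges `l` is a walk from `u` to `v` with at least one
edge. -/
def IsWalk {m : ℕ} (v : Fin 4 × Fin (m + 1)) : Fin 4 × Fin (m + 1) → List (PrismEdge m) → Prop
  | _, [] => False
  | u, e :: l => (src e = u ∧ (tgt e = v ∧ l = [] ∨ IsWalk v (tgt e) l)) ∨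
      (tgt e = u ∧ (src e = v ∧ l = [] ∨ IsWalk v (src e) l))

instance IsWalk.decidable {m : ℕ} (v : Fin 4 × Fin (m + 1)) :
    ∀ (u : Fin 4 × Fin (m + 1)) (l : List (PrismEdge m)), Decidable (IsWalk v u l)
  | _, [] => inferInstanceAs (Decidable False)
  | u, e :: l => by
    have := IsWalk.decidable v (tgt e) l
    have := IsWalk.decidable v (src e) l
    unfold IsWalk
    infer_instance

end PrismEdge

namespace IsWeakDrawing

variable {m : ℕ} {κ : Type*} {p : Fin 4 × Fin (m + 1) → ℂ} {S : PrismEdge m → Set ℂ}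
  {X : Finset κ} {lab : κ → Sym2 (PrismEdge m)}

theorem joinedIn_of_isWalk (h : IsWeakDrawing p S X lab) {T : Set (PrismEdge m)}
    {v : Fin 4 × Fin (m + 1)} : ∀ {u : Fin 4 × Fin (m + 1)} {l : List (PrismEdge m)},
      (∀ e ∈ l, e ∈ T) → IsWalk v u l → JoinedIn (⋃ e ∈ T, S e) (p u) (p v)
  | _, [], _, hl => hl.elim
  | u, e :: l, hT, hl => by
    have he := h.joinedIn_biUnion (hT e (by simp))
    have hT' : ∀ e ∈ l, e ∈ T := fun f hf => hT f (by simp [hf])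
    rcases hl with ⟨rfl, ⟨rfl, -⟩ | hl⟩ | ⟨rfl, ⟨rfl, -⟩ | hl⟩
    exacts [he, he.trans (h.joinedIn_of_isWalk hT' hl), he.symm,
      he.symm.trans (h.joinedIn_of_isWalk hT' hl)]

end IsWeakDrawing

/-- The branch vertices of the first colour class in two subdivisions of `K₃₃` in the product of
the diamond graph with a triangle. -/
def subdivisionLeft : Bool → Fin 3 → Fin 4 × Fin 3
  | false => ![(0, 2), (1, 2), (2, 0)]
  | true => ![(0, 0), (1, 1), (2, 1)]

/-- The branch vertices of the second colour class. -/
def subdivisionRight : Bool → Fin 3 → Fin 4 × Fin 3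
  | false => ![(1, 0), (2, 2), (0, 1)]
  | true => ![(0, 1), (1, 0), (3, 1)]

/-- The walks between the branch vertices. -/
def subdivisionWalk : Bool → Fin 3 → Fin 3 → List (PrismEdge 2)
  | false =>
    ![![[(Sum.inr 0, 2), (Sum.inl 0, 0)], [(Sum.inl 3, 2)], [(Sum.inr 0, 1)]],
      ![[(Sum.inr 1, 2)], [(Sum.inl 1, 2)], [(Sum.inr 1, 1), (Sum.inl 0, 1)]],
      ![[(Sum.inl 1, 0)], [(Sum.inr 2, 2)], [(Sum.inr 2, 0), (Sum.inl 3, 1)]]]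
  | true =>
    ![![[(Sum.inr 0, 0)], [(Sum.inl 0, 0)],
        [(Sum.inr 0, 2), (Sum.inl 3, 2), (Sum.inl 2, 2), (Sum.inr 3, 1)]],
      ![[(Sum.inl 0, 1)], [(Sum.inr 1, 0)], [(Sum.inl 4, 1)]],
      ![[(Sum.inl 3, 1)], [(Sum.inr 2, 0), (Sum.inl 1, 0)], [(Sum.inl 2, 1)]]]

/-- The digits of this number in base 16 describe the roles of the edges in the subdivisions: the
edges of the walk between the branch vertices `i` and `j` have the digit `4 * (i + 1) + (j + 1)`. -/
def subdivisionCode : Bool → ℕ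
  | false => 69626497470433179574942617781
  | true => 8873825050276713936955958681750

/-- The role of an edge in a subdivision. -/
def subdivisionRole (t : Bool) : PrismEdge 2 → ℕ
  | (Sum.inl a, i) => subdivisionCode t / 16 ^ (3 * (a : ℕ) + i) % 16
  | (Sum.inr k, i) => subdivisionCode t / 16 ^ (15 + 3 * (k : ℕ) + i) % 16

/-- Whether two edges lie in disjoint walks of the subdivision. -/
def subdivisionPair (t : Bool) (e f : PrismEdge 2) : Bool :=
  !(subdivisionRole t e).beq 0 && (!(subdivisionRole t f).beq 0 &&
    (!(subdivisionRole t e / 4).beq (subdivisionRole t f / 4) &&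
      !(subdivisionRole t e % 4).beq (subdivisionRole t f % 4)))

theorem isWalk_subdivisionWalk : ∀ t i j,
    IsWalk (subdivisionRight t j) (subdivisionLeft t i) (subdivisionWalk t i j) := by decide

theorem subdivisionRole_of_mem : ∀ t i j, ∀ e ∈ subdivisionWalk t i j,
    subdivisionRole t e = 4 * ((i : ℕ) + 1) + (j + 1) := by decide

theorem indep_of_subdivisionPair : ∀ t e f, subdivisionPair t e f = true → Indep e f := by
  decide +kernel

theorem IsWeakDrawing.exists_subdivisionPair {κ : Type*} {p : Fin 4 × Fin 3 → ℂ}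
    {S : PrismEdge 2 → Set ℂ} {X : Finset κ} {lab : κ → Sym2 (PrismEdge 2)}
    (h : IsWeakDrawing p S X lab) (t : Bool) :
    ∃ x ∈ X, ∃ e f, lab x = s(e, f) ∧ subdivisionPair t e f = true := by
  obtain ⟨i, j, i', j', hi, hj, z, hz, hz'⟩ := exists_inter_of_completeBipartite
    (fun i j => h.joinedIn_of_isWalk (T := {e | e ∈ subdivisionWalk t i j}) (fun _ he => he)
      (isWalk_subdivisionWalk t i j))
  have hp : ∀ e ∈ subdivisionWalk t i j, ∀ f ∈ subdivisionWalk t i' j',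
      subdivisionPair t e f = true := by
    intro e he f hf
    rw [subdivisionPair, subdivisionRole_of_mem t i j e he, subdivisionRole_of_mem t i' j' f hf]
    clear he hf hz hz'
    revert i j i' j'
    decide
  obtain ⟨x, hx, e, he, f, hf, hl⟩ := h.exists_of_mem hz hz'
    (fun e he f hf => indep_of_subdivisionPair t e f (hp e he f hf))
  exact ⟨x, hx, e, f, hl, hp e he f hf⟩

/-- The action of the Klein four-group on the vertices of the diamond graph. -/
def diamondAutVertex : Bool × Bool → Fin 4 → Fin 4
  | (false, false) => ![0, 1, 2, 3]
  | (true, false) => ![0, 2, 1, 3]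
  | (false, true) => ![3, 1, 2, 0]
  | (true, true) => ![3, 2, 1, 0]

/-- The action of the Klein four-group on the edges of the diamond graph. -/
def diamondAutEdge : Bool × Bool → Fin 5 → Fin 5
  | (false, false) => ![0, 1, 2, 3, 4]
  | (true, false) => ![3, 1, 4, 0, 2]
  | (false, true) => ![4, 1, 3, 2, 0]
  | (true, true) => ![2, 1, 0, 4, 3]

/-- An index set for the automorphisms of the product of the diamond graph with a triangle. -/
abbrev PrismAut : Type := (Bool × Bool) × (Bool × Fin 3)

namespace PrismAut

/-- The inverse of an automorphism. -/
def inv (g : PrismAut) : PrismAut := (g.1, g.2.1, if g.2.1 then g.2.2 else -g.2.2)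

/-- The action of the automorphisms on vertices. -/
def onVertex (g : PrismAut) (u : Fin 4 × Fin 3) : Fin 4 × Fin 3 :=
  (diamondAutVertex g.1 u.1, if g.2.1 then g.2.2 - u.2 else u.2 + g.2.2)

/-- The action of the automorphisms on edges. -/
def onEdge (g : PrismAut) : PrismEdge 2 → PrismEdge 2
  | (Sum.inl a, i) => (Sum.inl (diamondAutEdge g.1 a), if g.2.1 then g.2.2 - i else i + g.2.2)
  | (Sum.inr k, i) => (Sum.inr (diamondAutVertex g.1 k), if g.2.1 then g.2.2 - i - 1 else i + g.2.2)

theorem onEdge_inv_onEdge : ∀ g e, onEdge (inv g) (onEdge g e) = e := by decide +kernel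

theorem onVertex_inv_onVertex : ∀ g u, onVertex (inv g) (onVertex g u) = u := by decide +kernel

theorem endpoints_onEdge : ∀ g e,
    src (onEdge g e) = onVertex g (src e) ∧ tgt (onEdge g e) = onVertex g (tgt e) ∨
      src (onEdge g e) = onVertex g (tgt e) ∧ tgt (onEdge g e) = onVertex g (src e) := by
  decide +kernel

/-- The number of images of the two subdivisions in which two given edges lie on disjoint walks. -/
def pairCount (e f : PrismEdge 2) : ℕ :=
  ((Finset.univ : Finset (Bool × PrismAut)).filter fun g =>
    subdivisionPair g.1 (onEdge (inv g.2) e) (onEdge (inv g.2) f) = true).card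

theorem pairCount_le : ∀ e f, pairCount e f ≤ 8 := by decide +kernel

end PrismAut

theorem subdivisionPair_comm : ∀ t e f, subdivisionPair t e f = subdivisionPair t f e := by
  decide +kernel

namespace IsWeakDrawing

open PrismAut in
open Classical in
/-- The lower bound for three fibres, by counting the intersections in the images of two
subdivisions of `K₃₃` under the automorphism group. -/
theorem six_le_card {κ : Type*} {p : Fin 4 × Fin 3 → ℂ} {S : PrismEdge 2 → Set ℂ} {X : Finset κ}
    {lab : κ → Sym2 (PrismEdge 2)} (h : IsWeakDrawing p S X lab) : 6 ≤ X.card := by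
  let hit : Bool × PrismAut → κ → Prop := fun g x =>
    ∃ e f, (lab x).map (onEdge (inv g.2)) = s(e, f) ∧ subdivisionPair g.1 e f = true
  have h1 : ∀ g, 1 ≤ (X.filter (hit g)).card := fun g => by
    obtain ⟨x, hx, hxg⟩ := (h.comap (onVertex g.2) (onEdge g.2) (onEdge (inv g.2))
      (onEdge_inv_onEdge g.2) (endpoints_onEdge g.2)
      (Function.LeftInverse.injective (onVertex_inv_onVertex g.2))).exists_subdivisionPair g.1
    exact Finset.card_pos.2 ⟨x, Finset.mem_filter.2 ⟨hx, hxg⟩⟩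
  have h2 : ∀ x, ((Finset.univ : Finset (Bool × PrismAut)).filter fun g => hit g x).card ≤ 8 := by
    intro x
    obtain ⟨a, b, hz⟩ : ∃ a b, lab x = s(a, b) := by
      induction lab x with
      | _ a b => exact ⟨a, b, rfl⟩
    refine (Finset.card_le_card fun g hg => ?_).trans (pairCount_le a b)
    obtain ⟨e, f, hef, hp⟩ := (Finset.mem_filter.1 hg).2
    refine Finset.mem_filter.2 ⟨Finset.mem_univ g, ?_⟩
    rw [hz, Sym2.map_mk, Sym2.eq_iff] at hef
    rcases hef with ⟨rfl, rfl⟩ | ⟨rfl, rfl⟩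
    exacts [hp, (subdivisionPair_comm _ _ _).trans hp]
  have h3 : 48 ≤ X.card * 8 :=
    calc 48 = ∑ _g : Bool × PrismAut, 1 := by simp
      _ ≤ ∑ g, (X.filter (hit g)).card := Finset.sum_le_sum fun g _ => h1 g
      _ = ∑ x ∈ X, ((Finset.univ : Finset (Bool × PrismAut)).filter fun g => hit g x).card :=
        Finset.sum_card_bipartiteAbove_eq_sum_card_bipartiteBelow hit
      _ ≤ ∑ _x ∈ X, 8 := Finset.sum_le_sum fun x _ => h2 x
      _ = X.card * 8 := by simp
  omega

/-- A weak drawing of the product of the diamond graph with a cycle of length `m + 1` has at least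
`2 * (m + 1)` intersections. -/
theorem two_mul_le_card {κ : Type*} {m : ℕ} (hm : 2 ≤ m) : ∀ {p : Fin 4 × Fin (m + 1) → ℂ}
    {S : PrismEdge m → Set ℂ} {X : Finset κ} {lab : κ → Sym2 (PrismEdge m)},
    IsWeakDrawing p S X lab → 2 * (m + 1) ≤ X.card := by
  classical
  induction m, hm using Nat.le_induction with
  | base => exact fun h => h.six_le_card
  | succ m hm ih =>
    intro p S X lab h
    by_cases hE : ∀ i, ∃ a₀ : Fin 5, ∀ x ∈ X, ∀ a, (Sum.inl a, i) ∈ lab x → (Sum.inl a₀, i) ∈ lab x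
    · choose E hE using hE
      exact h.two_mul_le_card_of_forall_fibre (by omega) (fun x hx i a => hE i x hx a)
    · push Not at hE
      obtain ⟨i, hi⟩ := hE
      obtain ⟨x, hx, a, hxa, -⟩ := hi 0
      obtain ⟨y, hy, b, hyb, hya⟩ := hi a
      have hr := ih (h.rotate (i - Fin.last (m + 1))).removeLast
      set Y := X.filter fun x => ∀ e ∈ (lab x).map fun e : PrismEdge (m + 1) =>
        (e.1, e.2 - (i - Fin.last (m + 1))), Survives e with hY
      have hnot : ∀ x a, (Sum.inl a, i) ∈ lab x → x ∉ Y := fun x a hxa hxY =>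
        (Finset.mem_filter.1 hxY).2 _ (Sym2.mem_map.2 ⟨_, hxa, rfl⟩) a (by simp)
      have hxy : y ≠ x := fun e => hya (e ▸ hxa)
      have : insert y (insert x Y) ⊆ X := by
        simp [Finset.insert_subset_iff, hx, hy, hY, Finset.filter_subset]
      have := Finset.card_le_card this
      rw [Finset.card_insert_of_notMem (by simp [hxy, hnot y b hyb]),
        Finset.card_insert_of_notMem (hnot x a hxa)] at this
      omega

end IsWeakDrawing

/-! ### From drawings to weak drawings -/

namespace PrismEdge

variable {m : ℕ}

/-- The vertices of `G⁶₇₅ □ Cₙ` belonging to the diamond spanned by `v2`, `v3`, `v4`, `v5`. -/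
def toVertex (u : Fin 4 × Fin (m + 1)) : Fin 6 × Fin (m + 1) := (u.1.succ.castSucc, u.2)

theorem toVertex_injective : Function.Injective (toVertex (m := m)) := by
  rintro ⟨k, i⟩ ⟨l, j⟩ h
  simpa [toVertex] using h

theorem G6_75_adj_diamond (a : Fin 5) :
    G6_75.Adj (diamondSrc a).succ.castSucc (diamondTgt a).succ.castSucc := by
  rw [G6_75, fromEdgeSet_adj]
  revert a
  decide

theorem cycleGraph_adj_add_one (hm : 2 ≤ m) (i : Fin (m + 1)) :
    (cycleGraph (m + 1)).Adj i (i + 1) := by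
  obtain ⟨m, rfl⟩ := Nat.exists_eq_add_of_le' hm
  exact cycleGraph_adj.2 (Or.inr (by simp))

theorem adj_toVertex (hm : 2 ≤ m) (e : PrismEdge m) :
    (G6_75 □ cycleGraph (m + 1)).Adj (toVertex (src e)) (toVertex (tgt e)) := by
  rcases e with ⟨a | k, i⟩
  · exact boxProd_adj.2 (Or.inl ⟨G6_75_adj_diamond a, rfl⟩)
  · exact boxProd_adj.2 (Or.inr ⟨cycleGraph_adj_add_one hm i, rfl⟩)

/-- The edges of the subgraph of `G⁶₇₅ □ Cₙ` given by the diamond. -/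
def toEdge (hm : 2 ≤ m) (e : PrismEdge m) : (G6_75 □ cycleGraph (m + 1)).edgeSet :=
  ⟨s(toVertex (src e), toVertex (tgt e)), adj_toVertex hm e⟩

theorem toEdge_injective (hm : 2 ≤ m) : Function.Injective (toEdge hm) := by
  have key : ∀ a b, diamondSrc a = diamondSrc b ∧ diamondTgt a = diamondTgt b ∨
      diamondSrc a = diamondTgt b ∧ diamondTgt a = diamondSrc b → a = b := by decide
  have hne : ∀ a, diamondSrc a ≠ diamondTgt a := by decide
  intro e f h
  have h := congrArg Subtype.val h
  simp only [toEdge, Sym2.eq_iff, toVertex_injective.eq_iff] at h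
  rcases e with ⟨a | k, i⟩ <;> rcases f with ⟨b | l, j⟩ <;> simp only [src, tgt, Prod.mk.injEq] at h
  · obtain rfl := key a b (by tauto)
    rcases h with h | h <;> rw [h.1.2]
  · exact absurd (by rcases h with h | h <;> rw [h.1.1, h.2.1]) (hne a)
  · exact absurd (by rcases h with h | h <;> rw [← h.1.1, ← h.2.1]) (hne b)
  · rcases h with h | h
    · rw [h.1.1, h.1.2]
    · exact absurd (by rw [← h.1.2, ← h.2.2]; simp) (sub_one_ne_add_one hm j)

end PrismEdge

theorem Drawing.exists_arc_eq {V : Type*} {G : SimpleGraph V} (D : Drawing G) {e : G.edgeSet}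
    {u v : V} (he : (e : Sym2 V) = s(u, v)) :
    D.arc e 0 = D.vertexMap u ∧ D.arc e 1 = D.vertexMap v ∨
      D.arc e 0 = D.vertexMap v ∧ D.arc e 1 = D.vertexMap u := by
  obtain ⟨u', v', h, h0, h1⟩ := D.arc_endpoints e
  rcases Sym2.eq_iff.1 (he.symm.trans h) with ⟨rfl, rfl⟩ | ⟨rfl, rfl⟩
  exacts [Or.inl ⟨h0, h1⟩, Or.inr ⟨h0, h1⟩]

/-- Edges without a common endpoint can only meet at interior points of their arcs. -/
theorem Drawing.mem_Ioo_of_arc_eq {V : Type*} {G : SimpleGraph V} (D : Drawing G) {e f : G.edgeSet}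
    {u v u' v' : V} (he : (e : Sym2 V) = s(u, v)) (hf : (f : Sym2 V) = s(u', v'))
    (h1 : u ≠ u') (h2 : u ≠ v') (h3 : v ≠ u') (h4 : v ≠ v') {s t : ℝ}
    (hs : s ∈ Set.Icc (0 : ℝ) 1) (ht : t ∈ Set.Icc (0 : ℝ) 1) (hst : D.arc e s = D.arc f t) :
    s ∈ Set.Ioo (0 : ℝ) 1 := by
  have key : ∀ {e : G.edgeSet} {u v : V}, (e : Sym2 V) = s(u, v) → ∀ s ∈ Set.Icc (0 : ℝ) 1,
      s ∈ Set.Ioo (0 : ℝ) 1 ∨ D.arc e s = D.vertexMap u ∨ D.arc e s = D.vertexMap v := by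
    intro e u v he s hs
    rcases hs.1.eq_or_lt with rfl | h0
    · rcases D.exists_arc_eq he with h | h <;> simp [h.1]
    rcases hs.2.eq_or_lt with rfl | h1
    · rcases D.exists_arc_eq he with h | h <;> simp [h.2]
    exact Or.inl ⟨h0, h1⟩
  refine (key he s hs).resolve_right fun h => ?_
  rcases key hf t ht with ht | h'
  · rcases h with h | h <;> exact D.arc_avoids_vertices f t ht _ (hst.symm.trans h)
  · rw [← hst] at h'
    rcases h with h | h <;> rcases h' with h' | h'
    exacts [h1 (D.vertexMap_injective (h.symm.trans h')),
      h2 (D.vertexMap_injective (h.symm.trans h')), h3 (D.vertexMap_injective (h.symm.trans h')),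
      h4 (D.vertexMap_injective (h.symm.trans h'))]

theorem Drawing.two_mul_le_ncard_crossings {m : ℕ} (hm : 2 ≤ m)
    (D : Drawing (G6_75 □ cycleGraph (m + 1))) (hD : D.crossings.Finite) :
    2 * (m + 1) ≤ D.crossings.ncard := by
  let c := Complex.equivRealProdCLM.symm
  have hw : IsWeakDrawing (fun u => c (D.vertexMap (toVertex u)))
      (fun e => (fun t => c (D.arc (toEdge hm e) t)) '' Set.Icc 0 1) hD.toFinset
      (fun x => x.1.map (Function.invFun (toEdge hm))) := by
    refine ⟨fun e => ?_, ?_⟩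
    · have hc : ContinuousOn (fun t => c (D.arc (toEdge hm e) t)) (Set.Icc 0 1) :=
        c.continuous.comp_continuousOn (D.arc_continuousOn _)
      rcases D.exists_arc_eq (e := toEdge hm e) rfl with ⟨h0, h1⟩ | ⟨h0, h1⟩
      · exact JoinedIn.ofLine hc (by rw [h0]) (by rw [h1]) subset_rfl
      · exact (JoinedIn.ofLine hc (by rw [h0]) (by rw [h1]) subset_rfl).symm
    · rintro e f hef ⟨z, ⟨s, hs, rfl⟩, t, ht, hst⟩
      have hst := (c.injective hst).symm
      have hne : ∀ {u v : Fin 4 × Fin (m + 1)}, u ≠ v → toVertex u ≠ toVertex v := fun h =>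
        toVertex_injective.ne h
      refine ⟨(s(toEdge hm e, toEdge hm f), D.arc (toEdge hm e) s), ?_, ?_⟩
      · rw [Set.Finite.mem_toFinset]
        refine ⟨_, _, (toEdge_injective hm).ne fun h : e = f => hef.1 (h ▸ rfl), rfl, ⟨s, ?_, rfl⟩,
          t, ?_, hst.symm⟩
        · exact D.mem_Ioo_of_arc_eq rfl rfl (hne hef.1) (hne hef.2.1) (hne hef.2.2.1)
            (hne hef.2.2.2) hs ht hst
        · exact D.mem_Ioo_of_arc_eq rfl rfl (hne hef.symm.1) (hne hef.symm.2.1)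
            (hne hef.symm.2.2.1) (hne hef.symm.2.2.2) ht hs hst.symm
      · simp [Function.leftInverse_invFun (toEdge_injective hm) _]
  rw [Set.ncard_eq_toFinset_card _ hD]
  exact hw.two_mul_le_card hm

end PrismDrawing

/-! ### A drawing with few crossings -/

/-- The point at distance `r` from the origin with argument `2 * π * θ / n`. -/
noncomputable def polarPoint (n : ℕ) (θ r : ℝ) : ℝ × ℝ :=
  (r * Real.cos (θ * (2 * Real.pi / n)), r * Real.sin (θ * (2 * Real.pi / n)))

theorem polarPoint_add {n : ℕ} (hn : n ≠ 0) (θ r : ℝ) (z : ℤ) :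
    polarPoint n (θ + z * n) r = polarPoint n θ r := by
  have : (θ + z * n) * (2 * Real.pi / n) = θ * (2 * Real.pi / n) + z * (2 * Real.pi) := by
    field_simp
  simp only [polarPoint, this, Real.cos_add_int_mul_two_pi, Real.sin_add_int_mul_two_pi]

theorem eq_of_polarPoint_eq {n : ℕ} (hn : n ≠ 0) {θ θ' r r' : ℝ} (hr : 0 < r) (hr' : 0 < r')
    (h : polarPoint n θ r = polarPoint n θ' r') : r = r' ∧ ∃ z : ℤ, θ = θ' + z * n := by
  obtain ⟨h1, h2⟩ := Prod.ext_iff.1 h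
  simp only [polarPoint] at h1 h2
  have hrr : r = r' := by
    have : r ^ 2 = r' ^ 2 := by
      rw [← mul_one (r ^ 2), ← mul_one (r' ^ 2), ← Real.cos_sq_add_sin_sq (θ * (2 * Real.pi / n)),
        mul_add, ← mul_pow, ← mul_pow, h1, h2, mul_pow, mul_pow, ← mul_add, Real.cos_sq_add_sin_sq,
        Real.cos_sq_add_sin_sq]
    exact (sq_eq_sq₀ hr.le hr'.le).1 this
  subst hrr
  obtain ⟨z, hz⟩ := Real.Angle.angle_eq_iff_two_pi_dvd_sub.1 (Real.Angle.cos_sin_inj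
    (mul_left_cancel₀ hr.ne' h1) (mul_left_cancel₀ hr.ne' h2))
  refine ⟨rfl, z, ?_⟩
  have hpi := Real.pi_ne_zero
  field_simp at hz
  linarith

theorem continuous_polarPoint (n : ℕ) {f g : ℝ → ℝ} (hf : Continuous f) (hg : Continuous g) :
    Continuous fun t => polarPoint n (f t) (g t) := by
  unfold polarPoint
  fun_prop

theorem exists_val_add_one {m : ℕ} (j : Fin (m + 1)) :
    ∃ z : ℤ, (((j + 1 : Fin (m + 1)) : ℕ) : ℝ) = (j : ℕ) + 1 + z * (m + 1 : ℕ) := by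
  by_cases hj : j = Fin.last m
  · exact ⟨-1, by simp [hj]⟩
  · refine ⟨0, ?_⟩
    rw [Fin.val_add_one_of_lt (Fin.lt_last_iff_ne_last.2 hj)]
    simp

theorem eq_of_val_add_eq {m : ℕ} {i j : Fin (m + 1)} {d : ℝ} (h0 : -1 < d) (h1 : d < 1) {z : ℤ}
    (h : ((i : ℕ) : ℝ) + d = (j : ℕ) + z * (m + 1 : ℕ)) : d = 0 ∧ i = j := by
  have hd : d = ((j : ℕ) + z * (m + 1 : ℕ) - (i : ℕ) : ℤ) := by push_cast at h ⊢; linarith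
  rw [hd] at h0 h1
  have h0' : -1 < ((j : ℕ) + z * (m + 1 : ℕ) - (i : ℕ) : ℤ) := by exact_mod_cast h0
  have h1' : ((j : ℕ) + z * (m + 1 : ℕ) - (i : ℕ) : ℤ) < 1 := by exact_mod_cast h1
  have hz : ((j : ℕ) + z * (m + 1 : ℕ) - (i : ℕ) : ℤ) = 0 := by omega
  refine ⟨by rw [hd, hz]; simp, ?_⟩
  have hi : ((i : ℕ) : ℤ) < m + 1 := by exact_mod_cast i.isLt
  have hj : ((j : ℕ) : ℤ) < m + 1 := by exact_mod_cast j.isLt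
  have : z = 0 := by
    by_contra hz0
    push_cast at hz
    rcases lt_or_gt_of_ne hz0 with h | h
    · have := mul_nonneg (by lia : 0 ≤ -1 - z) (by lia : (0 : ℤ) ≤ m + 1)
      linarith
    · have := mul_nonneg (by lia : 0 ≤ z - 1) (by lia : (0 : ℤ) ≤ m + 1)
      linarith
  subst this
  ext
  omega

/-- First endpoints of the edges of `G⁶₇₅`. -/
def sixSrc : Fin 7 → Fin 6 := ![0, 1, 2, 3, 4, 1, 2]

/-- Second endpoints of the edges of `G⁶₇₅`. -/
def sixTgt : Fin 7 → Fin 6 := ![1, 2, 3, 4, 5, 3, 4]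

/-- The direction in which the edges of `G⁶₇₅` are bent in the drawing. -/
def sixBend : Fin 7 → ℝ := ![0, 0, 0, 0, 0, 1, -1]

/-- An index set for the edges of `G⁶₇₅ □ Cₙ`. -/
abbrev SixEdge (m : ℕ) : Type := (Fin 7 ⊕ Fin 6) × Fin (m + 1)

namespace SixEdge

variable {m : ℕ}

/-- The first endpoint of an edge. -/
def src : SixEdge m → Fin 6 × Fin (m + 1)
  | (Sum.inl a, i) => (sixSrc a, i)
  | (Sum.inr k, i) => (k, i)

/-- The second endpoint of an edge. -/
def tgt : SixEdge m → Fin 6 × Fin (m + 1)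
  | (Sum.inl a, i) => (sixTgt a, i)
  | (Sum.inr k, i) => (k, i + 1)

/-- The angle along an edge. -/
def angle : SixEdge m → ℝ → ℝ
  | (Sum.inl a, i), t => (i : ℕ) + sixBend a * (t * (1 - t))
  | (Sum.inr _, i), t => (i : ℕ) + t

/-- The radius along an edge. -/
def radius : SixEdge m → ℝ → ℝ
  | (Sum.inl a, _), t => (sixSrc a : ℕ) + 1 + (((sixTgt a : ℕ) : ℝ) - (sixSrc a : ℕ)) * t
  | (Sum.inr k, _), _ => (k : ℕ) + 1

theorem adj (hm : 2 ≤ m) (x : SixEdge m) : (G6_75 □ cycleGraph (m + 1)).Adj (src x) (tgt x) := by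
  rcases x with ⟨a | k, i⟩
  · refine boxProd_adj.2 (Or.inl ⟨?_, rfl⟩)
    simp only [src, tgt, G6_75, fromEdgeSet_adj]
    revert a
    decide
  · exact boxProd_adj.2 (Or.inr ⟨PrismEdge.cycleGraph_adj_add_one hm i, rfl⟩)

/-- The edge with a given index. -/
def toEdge (hm : 2 ≤ m) (x : SixEdge m) : (G6_75 □ cycleGraph (m + 1)).edgeSet :=
  ⟨s(src x, tgt x), adj hm x⟩

theorem toEdge_surjective (hm : 2 ≤ m) : Function.Surjective (toEdge hm) := by
  rintro ⟨e, he⟩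
  induction e with
  | _ u v =>
    obtain ⟨k, i⟩ := u
    obtain ⟨l, j⟩ := v
    rcases boxProd_adj.1 he with ⟨h, hij⟩ | ⟨h, hkl⟩
    · obtain rfl : i = j := hij
      have key : ∀ k l : Fin 6, s(k, l) ∈ ({s(0, 1), s(1, 2), s(2, 3), s(3, 4), s(4, 5), s(1, 3),
          s(2, 4)} : Set (Sym2 (Fin 6))) →
          ∃ a, k = sixSrc a ∧ l = sixTgt a ∨ k = sixTgt a ∧ l = sixSrc a := by decide
      rw [G6_75, fromEdgeSet_adj] at h
      obtain ⟨a, ⟨rfl, rfl⟩ | ⟨rfl, rfl⟩⟩ := key k l h.1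
      · exact ⟨(Sum.inl a, i), rfl⟩
      · exact ⟨(Sum.inl a, i), Subtype.ext Sym2.eq_swap⟩
    · obtain rfl : k = l := hkl
      obtain ⟨m, rfl⟩ := Nat.exists_eq_add_of_le' hm
      rcases cycleGraph_adj.1 h with h | h
      · replace h : i - j = 1 := h
        obtain rfl := sub_eq_iff_eq_add'.1 h
        exact ⟨(Sum.inr k, j), Subtype.ext Sym2.eq_swap⟩
      · replace h : j - i = 1 := h
        obtain rfl := sub_eq_iff_eq_add'.1 h
        exact ⟨(Sum.inr k, i), rfl⟩

theorem radius_pos (x : SixEdge m) {t : ℝ} (ht : t ∈ Set.Icc (0 : ℝ) 1) : 0 < radius x t := by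
  obtain ⟨h0, h1⟩ := ht
  rcases x with ⟨a | k, i⟩
  · have : (sixSrc a : ℕ) ≤ (sixTgt a : ℕ) := by revert a; decide
    have : ((sixSrc a : ℕ) : ℝ) ≤ (sixTgt a : ℕ) := by exact_mod_cast this
    have := mul_nonneg (sub_nonneg.2 this) h0
    simp only [radius]
    positivity
  · simp only [radius]
    positivity

theorem continuous_angle (x : SixEdge m) : Continuous (angle x) := by
  rcases x with ⟨a | k, i⟩ <;> unfold angle <;> fun_prop

theorem continuous_radius (x : SixEdge m) : Continuous (radius x) := by
  rcases x with ⟨a | k, i⟩ <;> unfold radius <;> fun_prop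

/-- The image of a vertex in the drawing. -/
noncomputable def vertexPoint (v : Fin 6 × Fin (m + 1)) : ℝ × ℝ :=
  polarPoint (m + 1) (v.2 : ℕ) ((v.1 : ℕ) + 1)

/-- The arc drawn for an edge. -/
noncomputable def point (x : SixEdge m) (t : ℝ) : ℝ × ℝ :=
  polarPoint (m + 1) (angle x t) (radius x t)

theorem vertexPoint_injective : Function.Injective (vertexPoint (m := m)) := by
  rintro ⟨k, i⟩ ⟨l, j⟩ h
  obtain ⟨hr, z, hz⟩ := eq_of_polarPoint_eq m.succ_ne_zero (by positivity) (by positivity) h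
  obtain rfl : k = l := Fin.ext (by exact_mod_cast add_right_cancel hr)
  obtain ⟨-, rfl⟩ := eq_of_val_add_eq (d := 0) (by norm_num) (by norm_num) (by simpa using hz)
  rfl

theorem continuous_point (x : SixEdge m) : Continuous (point x) :=
  continuous_polarPoint _ (continuous_angle x) (continuous_radius x)

theorem sixSrc_lt_sixTgt (a : Fin 7) : ((sixSrc a : ℕ) : ℝ) < (sixTgt a : ℕ) := by
  have : (sixSrc a : ℕ) < (sixTgt a : ℕ) := by revert a; decide
  exact_mod_cast this

theorem injOn_point (hm : 2 ≤ m) (x : SixEdge m) : Set.InjOn (point x) (Set.Icc 0 1) := by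
  intro s hs t ht h
  obtain ⟨hr, z, hz⟩ := eq_of_polarPoint_eq m.succ_ne_zero (radius_pos x hs) (radius_pos x ht) h
  rcases x with ⟨a | k, i⟩
  · have := sub_pos.2 (sixSrc_lt_sixTgt a)
    exact mul_left_cancel₀ this.ne' (add_left_cancel hr)
  · simp only [angle] at hz
    have h' : s - t = z * (m + 1 : ℕ) := by linarith
    have hm' : (2 : ℝ) ≤ m := by exact_mod_cast hm
    have hz0 : z = 0 := by
      by_contra hz0
      have : (1 : ℝ) ≤ |(z : ℝ)| := by exact_mod_cast Int.one_le_abs hz0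
      have hst : |s - t| ≤ 1 := abs_le.2 ⟨by linarith [hs.1, ht.2], by linarith [hs.2, ht.1]⟩
      rw [h', abs_mul, Nat.abs_cast] at hst
      push_cast at hst
      nlinarith
    subst hz0
    simp at h'
    linarith

theorem point_zero (x : SixEdge m) : point x 0 = vertexPoint (src x) := by
  rcases x with ⟨a | k, i⟩ <;> simp [point, vertexPoint, angle, radius, src]

theorem point_one (x : SixEdge m) : point x 1 = vertexPoint (tgt x) := by
  rcases x with ⟨a | k, i⟩
  · simp [point, vertexPoint, angle, radius, tgt, add_right_comm]
  · obtain ⟨z, hz⟩ := exists_val_add_one i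
    simp only [point, vertexPoint, angle, radius, tgt, hz, polarPoint_add m.succ_ne_zero]

theorem not_natCast_add_eq {p q : ℕ} {t : ℝ} (ht : t ∈ Set.Ioo (0 : ℝ) 1) :
    (p : ℝ) + t ≠ q := by
  intro h
  have h1 : (p : ℝ) < q := by linarith [ht.1]
  have h2 : (q : ℝ) < p + 1 := by linarith [ht.2]
  norm_cast at h1 h2
  omega

theorem mul_one_sub_mem {t : ℝ} (ht : t ∈ Set.Ioo (0 : ℝ) 1) :
    0 < t * (1 - t) ∧ t * (1 - t) ≤ 1 / 4 :=
  ⟨mul_pos ht.1 (by linarith [ht.2]), by nlinarith [sq_nonneg (t - 1 / 2)]⟩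

theorem abs_sixBend_mul_le (a : Fin 7) {t : ℝ} (ht : t ∈ Set.Ioo (0 : ℝ) 1) :
    |sixBend a * (t * (1 - t))| ≤ 1 / 4 := by
  obtain ⟨h0, h1⟩ := mul_one_sub_mem ht
  have : |sixBend a| ≤ 1 := by fin_cases a <;> simp [sixBend]
  rw [abs_mul, abs_of_pos h0]
  nlinarith [abs_nonneg (sixBend a)]

theorem sixTgt_eq_of_sixBend_eq_zero {a : Fin 7} (h : sixBend a = 0) :
    (sixTgt a : ℕ) = (sixSrc a : ℕ) + 1 := by
  fin_cases a <;> first | rfl | simp [sixBend] at h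

theorem point_ne_vertexPoint (x : SixEdge m) {t : ℝ} (ht : t ∈ Set.Ioo (0 : ℝ) 1)
    (v : Fin 6 × Fin (m + 1)) : point x t ≠ vertexPoint v := by
  intro h
  obtain ⟨hr, z, hz⟩ := eq_of_polarPoint_eq m.succ_ne_zero
    (radius_pos x (Set.Ioo_subset_Icc_self ht)) (by positivity) h
  rcases x with ⟨a | k, i⟩
  · have hb := abs_le.1 (abs_sixBend_mul_le a ht)
    obtain ⟨hd, -⟩ := eq_of_val_add_eq (by linarith [hb.1]) (by linarith [hb.2]) hz
    have ha := sixTgt_eq_of_sixBend_eq_zero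
      ((mul_eq_zero.1 hd).resolve_right (mul_one_sub_mem ht).1.ne')
    simp only [radius, ha] at hr
    push_cast at hr
    refine not_natCast_add_eq (p := sixSrc a) (q := v.1) ht ?_
    linarith
  · obtain ⟨hd, -⟩ := eq_of_val_add_eq (by linarith [ht.1]) ht.2 hz
    exact ht.1.ne' hd

/-- The pairs of edges which cross in the drawing. -/
def crossingPair : Fin (m + 1) × Bool → Sym2 (SixEdge m)
  | (i, false) => s((Sum.inl 5, i), (Sum.inr 2, i))
  | (i, true) => s((Sum.inl 6, i + 1), (Sum.inr 3, i))

/-- The crossing points of the drawing. -/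
noncomputable def crossingPoint : Fin (m + 1) × Bool → ℝ × ℝ
  | (i, false) => polarPoint (m + 1) ((i : ℕ) + 1 / 4) 3
  | (i, true) => polarPoint (m + 1) ((i : ℕ) + 3 / 4) 4

theorem eq_of_point_inl_eq {a b : Fin 7} {i j : Fin (m + 1)} {s t : ℝ}
    (hs : s ∈ Set.Ioo (0 : ℝ) 1) (ht : t ∈ Set.Ioo (0 : ℝ) 1)
    (h : point (Sum.inl a, i) s = point (Sum.inl b, j) t) : a = b ∧ i = j := by
  obtain ⟨hr, z, hz⟩ := eq_of_polarPoint_eq m.succ_ne_zero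
    (radius_pos _ (Set.Ioo_subset_Icc_self hs)) (radius_pos _ (Set.Ioo_subset_Icc_self ht)) h
  have ha := abs_le.1 (abs_sixBend_mul_le a hs)
  have hb := abs_le.1 (abs_sixBend_mul_le b ht)
  have hz' : ((i : ℕ) : ℝ) + (sixBend a * (s * (1 - s)) - sixBend b * (t * (1 - t))) =
      (j : ℕ) + z * (m + 1 : ℕ) := by
    simp only [angle] at hz
    linarith
  obtain ⟨hd, hij⟩ := eq_of_val_add_eq (by linarith [ha.1, hb.2]) (by linarith [ha.2, hb.1]) hz'
  refine ⟨?_, hij⟩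
  have hs' := (mul_one_sub_mem hs).1
  have ht' := (mul_one_sub_mem ht).1
  obtain ⟨hs0, hs1⟩ := hs
  obtain ⟨ht0, ht1⟩ := ht
  generalize s * (1 - s) = u at hd hs'
  generalize t * (1 - t) = v at hd ht'
  fin_cases a <;> fin_cases b <;> first
    | rfl
    | (exfalso
       simp [radius, sixSrc, sixTgt, sixBend] at hr hd
       linarith)

theorem eq_of_point_inr_eq {k l : Fin 6} {i j : Fin (m + 1)} {s t : ℝ}
    (hs : s ∈ Set.Ioo (0 : ℝ) 1) (ht : t ∈ Set.Ioo (0 : ℝ) 1)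
    (h : point (Sum.inr k, i) s = point (Sum.inr l, j) t) : k = l ∧ i = j := by
  obtain ⟨hr, z, hz⟩ := eq_of_polarPoint_eq m.succ_ne_zero
    (radius_pos _ (Set.Ioo_subset_Icc_self hs)) (radius_pos _ (Set.Ioo_subset_Icc_self ht)) h
  have hz' : ((i : ℕ) : ℝ) + (s - t) = (j : ℕ) + z * (m + 1 : ℕ) := by
    simp only [angle] at hz
    linarith
  exact ⟨Fin.ext (by exact_mod_cast add_right_cancel hr),
    (eq_of_val_add_eq (by linarith [hs.1, ht.2]) (by linarith [hs.2, ht.1]) hz').2⟩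

theorem exists_crossing_of_point_inl_eq {a : Fin 7} {k : Fin 6} {i j : Fin (m + 1)} {s t : ℝ}
    (hs : s ∈ Set.Ioo (0 : ℝ) 1) (ht : t ∈ Set.Ioo (0 : ℝ) 1)
    (h : point (Sum.inl a, i) s = point (Sum.inr k, j) t) :
    ∃ c, s((Sum.inl a, i), (Sum.inr k, j)) = crossingPair c ∧
      point (Sum.inr k, j) t = crossingPoint c := by
  obtain ⟨hr, z, hz⟩ := eq_of_polarPoint_eq m.succ_ne_zero
    (radius_pos _ (Set.Ioo_subset_Icc_self hs)) (radius_pos _ (Set.Ioo_subset_Icc_self ht)) h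
  have key : a = 5 ∧ k = 2 ∧ s = 1 / 2 ∨ a = 6 ∧ k = 3 ∧ s = 1 / 2 := by
    have hns := not_natCast_add_eq (p := sixSrc a) (q := k) hs
    obtain ⟨hs0, hs1⟩ := hs
    simp only [radius] at hr
    by_cases ha : (sixTgt a : ℕ) = (sixSrc a : ℕ) + 1
    · rw [ha] at hr
      push_cast at hr
      exact absurd (by linarith) hns
    · have ha' : a = 5 ∨ a = 6 := by clear hr hns h hz; revert a; decide
      rcases ha' with rfl | rfl
      · refine Or.inl ⟨rfl, ?_⟩
        fin_cases k <;> simp [sixSrc, sixTgt, hs0.ne'] at hr ⊢ <;> linarith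
      · refine Or.inr ⟨rfl, ?_⟩
        fin_cases k <;> simp [sixSrc, sixTgt, hs0.ne'] at hr ⊢ <;> linarith
  simp only [angle] at hz
  rcases key with ⟨rfl, rfl, rfl⟩ | ⟨rfl, rfl, rfl⟩
  · have hz' : ((i : ℕ) : ℝ) + (1 / 4 - t) = (j : ℕ) + z * (m + 1 : ℕ) := by
      simp [sixBend] at hz ⊢
      linarith
    obtain ⟨hd, rfl⟩ := eq_of_val_add_eq (by linarith [ht.2]) (by linarith [ht.1]) hz'
    refine ⟨(i, false), rfl, ?_⟩
    obtain rfl : t = 1 / 4 := by linarith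
    simp [point, crossingPoint, angle, radius]
    norm_num
  · obtain ⟨w, hw⟩ := exists_val_add_one j
    have hz' : ((i : ℕ) : ℝ) + (3 / 4 - t) = ((j + 1 : Fin (m + 1)) : ℕ) +
        (z - w : ℤ) * (m + 1 : ℕ) := by
      simp [sixBend] at hz hw ⊢
      linarith
    obtain ⟨hd, rfl⟩ := eq_of_val_add_eq (by linarith [ht.2]) (by linarith [ht.1]) hz'
    refine ⟨(j, true), rfl, ?_⟩
    obtain rfl : t = 3 / 4 := by linarith
    simp [point, crossingPoint, angle, radius]
    norm_num

theorem exists_crossing_of_point_eq {x y : SixEdge m} (hxy : x ≠ y) {s t : ℝ}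
    (hs : s ∈ Set.Ioo (0 : ℝ) 1) (ht : t ∈ Set.Ioo (0 : ℝ) 1) (h : point x s = point y t) :
    ∃ c, s(x, y) = crossingPair c ∧ point x s = crossingPoint c := by
  obtain ⟨a | k, i⟩ := x <;> obtain ⟨b | l, j⟩ := y
  · obtain ⟨rfl, rfl⟩ := eq_of_point_inl_eq hs ht h
    exact absurd rfl hxy
  · rw [h]
    exact exists_crossing_of_point_inl_eq hs ht h
  · rw [Sym2.eq_swap]
    exact exists_crossing_of_point_inl_eq ht hs h.symm
  · obtain ⟨rfl, rfl⟩ := eq_of_point_inr_eq hs ht h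
    exact absurd rfl hxy

/-- A drawing of `G⁶₇₅ □ Cₘ₊₁` whose only crossings are those of each chord of `G⁶₇₅` with one
edge of a cycle. -/
noncomputable def drawing (hm : 2 ≤ m) : Drawing (G6_75 □ cycleGraph (m + 1)) where
  vertexMap := vertexPoint
  vertexMap_injective := vertexPoint_injective
  arc e := point (Function.surjInv (toEdge_surjective hm) e)
  arc_continuousOn _ := (continuous_point _).continuousOn
  arc_injOn _ := injOn_point hm _
  arc_endpoints e := ⟨_, _, congrArg Subtype.val
    (Function.surjInv_eq (toEdge_surjective hm) e).symm, point_zero _, point_one _⟩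
  arc_avoids_vertices _ _ ht := point_ne_vertexPoint _ ht

theorem crossings_drawing_subset (hm : 2 ≤ m) : (drawing hm).crossings ⊆
    Set.range fun c : Fin (m + 1) × Bool => ((crossingPair c).map (toEdge hm), crossingPoint c) := by
  rintro ⟨_, p⟩ ⟨e, f, hef, rfl, ⟨s, hs, hsp⟩, t, ht, htp⟩
  have hinv := Function.surjInv_eq (toEdge_surjective hm)
  obtain ⟨c, hc, hc'⟩ := exists_crossing_of_point_eq
    (fun h => hef (by rw [← hinv e, h, hinv f])) hs ht (hsp.trans htp.symm)
  refine ⟨c, Prod.ext ?_ (hc'.symm.trans hsp)⟩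
  dsimp only
  rw [← hc, Sym2.map_mk, hinv, hinv]

end SixEdge

/-- The crossing number of `G⁶₇₅ □ Cₙ` is `2n` for all `n ≥ 4`. -/
theorem crossingNumber_G6_75_boxProd_cycle (n : ℕ) (hn : 4 ≤ n) :
    crossingNumber (G6_75 □ SimpleGraph.cycleGraph n) = 2 * n := by
  obtain ⟨m, rfl⟩ : ∃ m, n = m + 1 := ⟨n - 1, by omega⟩
  have hm : 2 ≤ m := by omega
  have hsub := SixEdge.crossings_drawing_subset hm
  have hfin : (SixEdge.drawing hm).crossings.Finite := (Set.finite_range _).subset hsub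
  have hcard : (SixEdge.drawing hm).crossings.ncard ≤ 2 * (m + 1) := by
    refine (Set.ncard_le_ncard hsub (Set.finite_range _)).trans ?_
    rw [← Set.image_univ]
    refine (Set.ncard_image_le Set.finite_univ).trans ?_
    simp [Set.ncard_univ, mul_comm]
  have hmem : (SixEdge.drawing hm).crossings.ncard ∈
      {k : ℕ | ∃ D : Drawing (G6_75 □ cycleGraph (m + 1)),
        D.crossings.Finite ∧ D.crossings.ncard = k} := ⟨SixEdge.drawing hm, hfin, rfl⟩
  refine le_antisymm ((Nat.sInf_le hmem).trans hcard) ?_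
  obtain ⟨D, hD, hDn⟩ := Nat.sInf_mem ⟨_, hmem⟩
  exact (D.two_mul_le_ncard_crossings hm hD).trans_eq hDn
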